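/- Let W be a complex vector space, D, F ∈ End(W), A ⊆ End(W) a unital subalgebra, and let Σ²D := D⊗1 + F⊗N ∈ End(W⊗V). Then for every a ∈ A, every n ≥ 1, and all i, j ∈ ℕ, there exist finitely many tuples (x_{0k}, x_{1k}, …, x_{nk}) of elements of A⊗𝒮 such that Σ_k x_{0k}·[Σ²D, x_{1k}]⋯[Σ²D, x_{nk}] = 0 while Σ_k [Σ²D, x_{0k}]·[Σ²D, x_{1k}]⋯[Σ²D, x_{nk}] = a F^{n+1} ⊗ e_{ij}. (This is the exact form of the paper's Lemma that F^{n+1}a ⊗ e_{ij} belongs to π(dJ₀ⁿ(A⊗𝒮)) for all n ≥ 1.) -/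

import Mathlib

open scoped TensorProduct

noncomputable section

/-- `V` is the ℂ-vector space of finitely supported sequences `ℕ → ℂ`. -/
def V : Type := ℕ →₀ ℂ

instance : AddCommGroup V := inferInstanceAs (AddCommGroup (ℕ →₀ ℂ))
instance : Module ℂ V := inferInstanceAs (Module ℂ (ℕ →₀ ℂ))

/-- The number operator `N`, determined by `N e_k = k e_k`. -/
def Nop : Module.End ℂ V := Finsupp.lsum ℂ fun k => (k : ℂ) • Finsupp.lsingle k

/-- The matrix unit `e_{ij}`, determined by `e_{ij} e_k = δ_{jk} e_i`. -/
def matUnit (i j : ℕ) : Module.End ℂ V := (Finsupp.lapply j).smulRight (Finsupp.single i 1)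

/-- `𝒮`, the linear span of the matrix units (the finitely supported matrices). -/
def finS : Submodule ℂ (Module.End ℂ V) :=
  Submodule.span ℂ (Set.range fun p : ℕ × ℕ => matUnit p.1 p.2)

/-- The commutator `[x, y] = x*y − y*x`. -/
def brkt {R : Type*} [Ring R] (x y : R) : R := x * y - y * x

variable {W : Type*} [AddCommGroup W] [Module ℂ W]

/-- `x ⊗ y` as an endomorphism of `W ⊗ V`, acting factorwise. -/
def tmul2 (x : Module.End ℂ W) (y : Module.End ℂ V) : Module.End ℂ (W ⊗[ℂ] V) :=
  TensorProduct.map x y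

/-- `A ⊗ 𝒮` inside `End(W ⊗ V)`: the linear span of the operators `b ⊗ T` with
`b ∈ A` and `T ∈ 𝒮`. -/
def AtSgen (A : Subalgebra ℂ (Module.End ℂ W)) :
    Submodule ℂ (Module.End ℂ (W ⊗[ℂ] V)) :=
  Submodule.span ℂ {x : Module.End ℂ (W ⊗[ℂ] V) |
    ∃ (b : Module.End ℂ W) (T : Module.End ℂ V), b ∈ A ∧ T ∈ finS ∧ x = tmul2 b T}

theorem Nop_apply (v : ℕ →₀ ℂ) (j : ℕ) : DFunLike.coe (F := ℕ →₀ ℂ) (Nop v) j = j * v j := by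
  change (v.sum fun k d => ((k : ℂ) • Finsupp.single k d : ℕ →₀ ℂ)) j = _
  rw [Finsupp.sum_apply, Finsupp.sum_eq_single j]
  · simp
  · intro k _ hk
    simp [hk]
  · simp

theorem matUnit_mul_matUnit (i j k : ℕ) : matUnit i j * matUnit j k = matUnit i k := by
  refine LinearMap.ext fun (v : ℕ →₀ ℂ) => ?_
  change ((v k • Finsupp.single j 1 : ℕ →₀ ℂ) j • Finsupp.single i 1 : ℕ →₀ ℂ) =
    (v k • Finsupp.single i 1 : ℕ →₀ ℂ)
  simp

theorem Nop_mul_matUnit (i j : ℕ) : Nop * matUnit i j = (i : ℂ) • matUnit i j := by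
  refine LinearMap.ext fun v => ?_
  rw [Module.End.mul_apply, LinearMap.smul_apply]
  refine Finsupp.ext fun k => (Nop_apply (matUnit i j v) k).trans ?_
  change (k : ℂ) * (DFunLike.coe (F := ℕ →₀ ℂ) v j • Finsupp.single i 1 : ℕ →₀ ℂ) k =
    ((i : ℂ) • DFunLike.coe (F := ℕ →₀ ℂ) v j • Finsupp.single i 1 : ℕ →₀ ℂ) k
  by_cases h : i = k
  · simp [h]
  · simp [Finsupp.single_eq_of_ne' h]

theorem matUnit_mul_Nop (i j : ℕ) : matUnit i j * Nop = (j : ℂ) • matUnit i j := by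
  refine LinearMap.ext fun (v : ℕ →₀ ℂ) => ?_
  change (DFunLike.coe (F := ℕ →₀ ℂ) (Nop v) j • Finsupp.single i 1 : ℕ →₀ ℂ) =
    ((j : ℂ) • v j • Finsupp.single i 1 : ℕ →₀ ℂ)
  rw [Nop_apply, mul_smul]

theorem tmul2_mul_tmul2 (x x' : Module.End ℂ W) (y y' : Module.End ℂ V) :
    tmul2 x y * tmul2 x' y' = tmul2 (x * x') (y * y') :=
  (TensorProduct.map_comp x y x' y').symm

theorem tmul2_add_left (x x' : Module.End ℂ W) (y : Module.End ℂ V) :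
    tmul2 (x + x') y = tmul2 x y + tmul2 x' y :=
  TensorProduct.map_add_left x x' y

theorem tmul2_smul_left (c : ℂ) (x : Module.End ℂ W) (y : Module.End ℂ V) :
    tmul2 (c • x) y = c • tmul2 x y :=
  TensorProduct.map_smul_left c x y

theorem tmul2_smul_right (c : ℂ) (x : Module.End ℂ W) (y : Module.End ℂ V) :
    tmul2 x (c • y) = c • tmul2 x y :=
  TensorProduct.map_smul_right c x y

theorem tmul2_sub_left (x x' : Module.End ℂ W) (y : Module.End ℂ V) :
    tmul2 (x - x') y = tmul2 x y - tmul2 x' y := by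
  rw [eq_sub_iff_add_eq, ← tmul2_add_left, sub_add_cancel]

theorem tmul2_matUnit_mem_AtSgen {A : Subalgebra ℂ (Module.End ℂ W)} {b : Module.End ℂ W}
    (hb : b ∈ A) (p q : ℕ) : tmul2 b (matUnit p q) ∈ AtSgen A :=
  Submodule.subset_span ⟨b, matUnit p q, hb, Submodule.subset_span ⟨(p, q), rfl⟩, rfl⟩

theorem brkt_tmul2_matUnit (D F b : Module.End ℂ W) (p q : ℕ) :
    brkt (tmul2 D 1 + tmul2 F Nop) (tmul2 b (matUnit p q)) =
      tmul2 (brkt D b + ((p : ℂ) • (F * b) - (q : ℂ) • (b * F))) (matUnit p q) := by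
  simp only [brkt, add_mul, mul_add, tmul2_mul_tmul2, one_mul, mul_one, Nop_mul_matUnit,
    matUnit_mul_Nop, tmul2_add_left, tmul2_sub_left, tmul2_smul_left, tmul2_smul_right]
  abel

theorem brkt_tmul2_one_matUnit (D F : Module.End ℂ W) (p q : ℕ) :
    brkt (tmul2 D 1 + tmul2 F Nop) (tmul2 1 (matUnit p q)) =
      tmul2 (((p : ℂ) - q) • F) (matUnit p q) := by
  rw [brkt_tmul2_matUnit]
  simp [brkt, sub_smul]

/-- A product of commutators along the path `j + s n → j + s (n - 1) → ⋯ → j` of matrix units. -/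
theorem tmul2_mul_prod_brkt (D F : Module.End ℂ W) (s i j n : ℕ) (b : Module.End ℂ W) :
    tmul2 b (matUnit i (j + s * n)) *
        (List.ofFn fun k : Fin n => brkt (tmul2 D 1 + tmul2 F Nop)
          (tmul2 1 (matUnit (j + s * (n - k)) (j + s * (n - (k + 1)))))).prod =
      (s : ℂ) ^ n • tmul2 (b * F ^ n) (matUnit i j) := by
  induction n generalizing b with
  | zero => simp
  | succ n ih =>
    have h : ((j + s * (n + 1) : ℕ) : ℂ) - (j + s * n : ℕ) = s := by
      push_cast
      ring
    rw [List.ofFn_succ, List.prod_cons, ← mul_assoc]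
    simp only [Fin.val_zero, Fin.val_succ, Nat.sub_zero, zero_add, Nat.add_sub_cancel,
      Nat.add_sub_add_right]
    rw [brkt_tmul2_one_matUnit, tmul2_mul_tmul2, matUnit_mul_matUnit, ih, h, mul_smul_comm,
      smul_mul_assoc, tmul2_smul_left, smul_smul, mul_assoc, ← pow_succ', ← pow_succ]

/-- With `Σ²D = D⊗1 + F⊗N` on `W ⊗ V`: for every `a ∈ A`, `n ≥ 1` and `i, j ∈ ℕ`
there are finitely many tuples `(x₀ₖ, …, x_{nk})` of elements of `A⊗𝒮` with
`Σₖ x₀ₖ·[Σ²D,x₁ₖ]⋯[Σ²D,x_{nk}] = 0` and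
`Σₖ [Σ²D,x₀ₖ]·[Σ²D,x₁ₖ]⋯[Σ²D,x_{nk}] = a F^{n+1} ⊗ e_{ij}`. -/
theorem stmt_11 (D F : Module.End ℂ W) (A : Subalgebra ℂ (Module.End ℂ W))
    (a : Module.End ℂ W) (ha : a ∈ A) (n : ℕ) (hn : 1 ≤ n) (i j : ℕ) :
    ∃ (K : ℕ) (x0 : Fin K → Module.End ℂ (W ⊗[ℂ] V))
      (xr : Fin K → Fin n → Module.End ℂ (W ⊗[ℂ] V)),
      (∀ k, x0 k ∈ AtSgen A) ∧ (∀ k i', xr k i' ∈ AtSgen A) ∧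
      (∑ k, x0 k *
        (List.ofFn fun i' => brkt (tmul2 D 1 + tmul2 F Nop) (xr k i')).prod = 0) ∧
      (∑ k, brkt (tmul2 D 1 + tmul2 F Nop) (x0 k) *
          (List.ofFn fun i' => brkt (tmul2 D 1 + tmul2 F Nop) (xr k i')).prod
        = tmul2 (a * F ^ (n + 1)) (matUnit i j)) := by
  have hn0 : (n : ℂ) ≠ 0 := Nat.cast_ne_zero.mpr (by omega)
  refine ⟨2, ![tmul2 ((1 / n : ℂ) • a) (matUnit i (j + 1 * n)),
      tmul2 ((-(1 / (n * 2 ^ n)) : ℂ) • a) (matUnit i (j + 2 * n))],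
    ![fun k => tmul2 1 (matUnit (j + 1 * (n - k)) (j + 1 * (n - (k + 1)))),
      fun k => tmul2 1 (matUnit (j + 2 * (n - k)) (j + 2 * (n - (k + 1))))],
    ?_, ?_, ?_, ?_⟩
  · intro k
    fin_cases k
    · exact tmul2_matUnit_mem_AtSgen (A.smul_mem ha _) _ _
    · exact tmul2_matUnit_mem_AtSgen (A.smul_mem ha _) _ _
  · intro k i'
    fin_cases k
    · exact tmul2_matUnit_mem_AtSgen A.one_mem _ _
    · exact tmul2_matUnit_mem_AtSgen A.one_mem _ _
  · simp only [Fin.sum_univ_two, Matrix.cons_val_zero, Matrix.cons_val_one]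
    rw [tmul2_mul_prod_brkt, tmul2_mul_prod_brkt, smul_mul_assoc, smul_mul_assoc,
      tmul2_smul_left, tmul2_smul_left, smul_smul, smul_smul, ← add_smul]
    convert zero_smul ℂ _
    push_cast
    field_simp
    simp
  · simp only [Fin.sum_univ_two, Matrix.cons_val_zero, Matrix.cons_val_one]
    rw [brkt_tmul2_matUnit D F ((1 / n : ℂ) • a), brkt_tmul2_matUnit D F (_ • a),
      tmul2_mul_prod_brkt, tmul2_mul_prod_brkt, ← tmul2_smul_left, ← tmul2_smul_left,
      ← tmul2_add_left]
    congr 1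
    simp only [brkt, pow_succ' F n, ← mul_assoc, ← smul_mul_assoc, ← add_mul]
    congr 1
    simp only [mul_smul_comm, smul_mul_assoc]
    match_scalars <;> field_simp <;> ring
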